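/- Let S be a geometric simplicial complex of dimension n that is a pseudo-manifold, i.e. S is non-branching (every (n−1)-simplex of S is a face of exactly one or exactly two n-simplices of S), strongly connected (any two n-simplices σ, σ′ of S can be joined by a finite sequence of n-simplices of S in which any two consecutive simplices share a common (n−1)-face), and dimensionally homogeneous (every simplex of S is a face of some n-simplex of S). Then every subdivision S′ of S is also an n-dimensional pseudo-manifold. -/

import Mathlib

open scoped Classical
open Finset

/-- A finite geometric simplicial complex in a real vector space `E`: a finite
collection of vertex sets of geometric simplices (finite affinely independent sets),
closed under passing to nonempty subsets (faces), such that the intersection of any two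
of its geometric simplices (convex hulls of the vertex sets) is a face of each. -/
structure GeomComplex (E : Type*) [AddCommGroup E] [Module ℝ E] where
  faces : Finset (Finset E)
  nonempty_of_mem : ∀ σ ∈ faces, σ.Nonempty
  indep : ∀ σ ∈ faces, AffineIndependent ℝ ((↑) : σ → E)
  down_closed : ∀ σ ∈ faces, ∀ τ ⊆ σ, τ.Nonempty → τ ∈ faces
  inter_face : ∀ σ ∈ faces, ∀ τ ∈ faces,
    convexHull ℝ (σ : Set E) ∩ convexHull ℝ (τ : Set E) =
      convexHull ℝ ((σ ∩ τ : Finset E) : Set E)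

variable {E : Type*} [AddCommGroup E] [Module ℝ E]

/-- `S'` is a subdivision of `S` if every simplex of `S'` is contained in a simplex of
`S` and every simplex of `S` is the union of the simplices of `S'` contained in it. -/
def IsSubdivision (S' S : GeomComplex E) : Prop :=
  (∀ σ' ∈ S'.faces, ∃ σ ∈ S.faces,
      convexHull ℝ (σ' : Set E) ⊆ convexHull ℝ (σ : Set E)) ∧
  ∀ σ ∈ S.faces, convexHull ℝ (σ : Set E) =
    ⋃ σ' ∈ S'.faces.filter (fun τ =>
        convexHull ℝ (τ : Set E) ⊆ convexHull ℝ (σ : Set E)),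
      convexHull ℝ (σ' : Set E)

/-- `S` has dimension `n`: it contains an `n`-simplex and no simplex of larger
dimension. -/
def GeomComplex.HasDim (S : GeomComplex E) (n : ℕ) : Prop :=
  (∃ σ ∈ S.faces, σ.card = n + 1) ∧ ∀ σ ∈ S.faces, σ.card ≤ n + 1

/-- `S` is non-branching: every `(n-1)`-simplex of `S` is a face of exactly one or
exactly two `n`-simplices of `S`. -/
def NonBranching (S : GeomComplex E) (n : ℕ) : Prop :=
  ∀ τ ∈ S.faces, τ.card = n →
    (S.faces.filter fun σ => τ ⊆ σ ∧ σ.card = n + 1).card = 1 ∨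
    (S.faces.filter fun σ => τ ⊆ σ ∧ σ.card = n + 1).card = 2

/-- `S` is strongly connected: any two `n`-simplices of `S` can be joined by a finite
sequence of `n`-simplices of `S` in which any two consecutive simplices share a common
`(n-1)`-face. -/
def StronglyConnected (S : GeomComplex E) (n : ℕ) : Prop :=
  ∀ σ ∈ S.faces, σ.card = n + 1 → ∀ σ' ∈ S.faces, σ'.card = n + 1 →
    ∃ (k : ℕ) (c : ℕ → Finset E), c 0 = σ ∧ c k = σ' ∧
      (∀ i ≤ k, c i ∈ S.faces ∧ (c i).card = n + 1) ∧
      ∀ i < k, ∃ τ ∈ S.faces, τ.card = n ∧ τ ⊆ c i ∧ τ ⊆ c (i + 1)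

/-- `S` is dimensionally homogeneous: every simplex of `S` is a face of some
`n`-simplex of `S`. -/
def DimHomogeneous (S : GeomComplex E) (n : ℕ) : Prop :=
  ∀ σ ∈ S.faces, ∃ σ' ∈ S.faces, σ'.card = n + 1 ∧ σ ⊆ σ'

/-- `S` is an `n`-dimensional pseudo-manifold: it has dimension `n` and is
non-branching, strongly connected and dimensionally homogeneous. -/
def IsPseudoManifold (S : GeomComplex E) (n : ℕ) : Prop :=
  S.HasDim n ∧ NonBranching S n ∧ StronglyConnected S n ∧ DimHomogeneous S n

section ConvexGeometry

variable {V W : Type*} [AddCommGroup V] [Module ℝ V] [AddCommGroup W] [Module ℝ W]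

/-- A family of affine functions restricting to the barycentric coordinates of `σ`. -/
def IsBarycentric (σ : Finset V) (b : V → V →ᵃ[ℝ] ℝ) : Prop :=
  ∀ v ∈ σ, ∀ w ∈ σ, b v w = if v = w then 1 else 0

lemma exists_isBarycentric {σ : Finset V} (h : AffineIndependent ℝ ((↑) : σ → V)) :
    ∃ b, IsBarycentric σ b := by
  obtain ⟨t, hσt, hind, hspan⟩ :=
    exists_subset_affineIndependent_affineSpan_eq_top (k := ℝ) (s := (σ : Set V)) h
  let B : AffineBasis t ℝ V := ⟨(↑), hind, by simpa using hspan⟩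
  refine ⟨fun v => if hv : v ∈ t then B.coord ⟨v, hv⟩ else 0, fun v hv w hw => ?_⟩
  have hw' : w = B ⟨w, hσt hw⟩ := rfl
  have hvt : v ∈ t := hσt hv
  simp only [hvt, dif_pos]
  conv_lhs => rw [hw', B.coord_apply]
  simp

lemma IsBarycentric.map_eq_sum {σ : Finset V} {b : V → V →ᵃ[ℝ] ℝ} (hb : IsBarycentric σ b)
    (g : V →ᵃ[ℝ] W) {x : V} (hx : x ∈ affineSpan ℝ (σ : Set V)) :
    g x = ∑ v ∈ σ, b v x • g v := by
  refine affineSpan_induction (p := fun x => g x = ∑ v ∈ σ, b v x • g v) hx (fun x hx => ?_)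
    fun c u v w hu hv hw => ?_
  · rw [Finset.sum_congr rfl fun v hv => by rw [hb v hv x hx]]
    have hx' : x ∈ σ := hx
    simp [hx']
  · simp only [AffineMap.map_vadd, map_smul, AffineMap.linearMap_vsub]
    simp only [vsub_eq_sub, vadd_eq_add, smul_eq_mul, add_smul, mul_smul, sub_smul,
      Finset.sum_add_distrib, ← Finset.smul_sum,
      Finset.sum_sub_distrib, ← hu, ← hv, ← hw]

lemma IsBarycentric.sum_eq_one {σ : Finset V} {b : V → V →ᵃ[ℝ] ℝ} (hb : IsBarycentric σ b)
    {x : V} (hx : x ∈ affineSpan ℝ (σ : Set V)) : ∑ v ∈ σ, b v x = 1 := by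
  simpa using (hb.map_eq_sum (AffineMap.const ℝ V (1 : ℝ)) hx).symm

lemma IsBarycentric.sum_smul_eq {σ : Finset V} {b : V → V →ᵃ[ℝ] ℝ} (hb : IsBarycentric σ b)
    {x : V} (hx : x ∈ affineSpan ℝ (σ : Set V)) : ∑ v ∈ σ, b v x • v = x := by
  simpa using (hb.map_eq_sum (AffineMap.id ℝ V) hx).symm

lemma affineMap_nonneg_of_mem_convexHull {s : Set V} (f : V →ᵃ[ℝ] ℝ) (hf : ∀ v ∈ s, 0 ≤ f v)
    {x : V} (hx : x ∈ convexHull ℝ s) : 0 ≤ f x :=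
  convexHull_min (t := f ⁻¹' Set.Ici 0) hf ((convex_Ici 0).affine_preimage f) hx

lemma affineMap_eq_zero_of_mem_convexHull {s : Set V} (f : V →ᵃ[ℝ] ℝ) (hf : ∀ v ∈ s, f v = 0)
    {x : V} (hx : x ∈ convexHull ℝ s) : f x = 0 :=
  convexHull_min (t := f ⁻¹' {0}) hf ((convex_singleton 0).affine_preimage f) hx

lemma IsBarycentric.nonneg {σ : Finset V} {b : V → V →ᵃ[ℝ] ℝ} (hb : IsBarycentric σ b)
    {x : V} (hx : x ∈ convexHull ℝ (σ : Set V)) {v : V} (hv : v ∈ σ) : 0 ≤ b v x :=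
  affineMap_nonneg_of_mem_convexHull _
    (fun w hw => by rw [hb v hv w hw]; split_ifs <;> norm_num) hx

lemma IsBarycentric.eq_zero {σ T : Finset V} {b : V → V →ᵃ[ℝ] ℝ} (hb : IsBarycentric σ b)
    (hT : T ⊆ σ) {x : V} (hx : x ∈ convexHull ℝ (T : Set V)) {v : V} (hv : v ∈ σ) (hvT : v ∉ T) :
    b v x = 0 :=
  affineMap_eq_zero_of_mem_convexHull _
    (fun w hw => by
      rw [hb v hv w (hT hw), if_neg]
      rintro rfl
      exact hvT hw) hx

lemma IsBarycentric.mem_convexHull {σ T : Finset V} {b : V → V →ᵃ[ℝ] ℝ} (hb : IsBarycentric σ b)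
    {x : V} (hx : x ∈ affineSpan ℝ (σ : Set V)) (hT : T ⊆ σ) (h0 : ∀ v ∈ T, 0 ≤ b v x)
    (h1 : ∀ v ∈ σ, v ∉ T → b v x = 0) : x ∈ convexHull ℝ (T : Set V) := by
  refine Finset.mem_convexHull'.2 ⟨fun v => b v x, h0, ?_, ?_⟩
  · rw [Finset.sum_subset hT h1, hb.sum_eq_one hx]
  · rw [Finset.sum_subset hT fun v hv hv' => by simp [h1 v hv hv'], hb.sum_smul_eq hx]

/-- A point in the relative interior of a finite convex hull, tested by affine functions. -/
lemma exists_mem_convexHull_forall_affineMap {τ : Finset V} (h : τ.Nonempty) :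
    ∃ x ∈ convexHull ℝ (τ : Set V), ∀ f : V →ᵃ[ℝ] ℝ,
      (∀ t ∈ τ, 0 ≤ f t) → f x = 0 → ∀ t ∈ τ, f t = 0 := by
  have hc : (0 : ℝ) < τ.card := by exact_mod_cast h.card_pos
  refine ⟨∑ t ∈ τ, (τ.card : ℝ)⁻¹ • t, Finset.mem_convexHull'.2
    ⟨fun _ => (τ.card : ℝ)⁻¹, fun _ _ => by positivity, ?_, rfl⟩, fun f hf hfx t ht => ?_⟩
  · rw [Finset.sum_const, nsmul_eq_mul, mul_inv_cancel₀ hc.ne']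
  · have key : f (∑ t ∈ τ, (τ.card : ℝ)⁻¹ • t) = (τ.card : ℝ)⁻¹ * ∑ t ∈ τ, f t := by
      have hd : ∀ y, f y = f.linear y + f 0 := fun y => congrFun f.decomp y
      rw [hd, map_sum, Finset.sum_congr rfl fun t _ => hd t, Finset.sum_add_distrib,
        Finset.sum_const, nsmul_eq_mul, mul_add, ← mul_assoc, inv_mul_cancel₀ hc.ne', one_mul,
        Finset.mul_sum]
      simp
    rw [key, mul_eq_zero, or_iff_right (inv_ne_zero hc.ne')] at hfx
    exact (Finset.sum_eq_zero_iff_of_nonneg hf).1 hfx t ht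

lemma subset_of_mem_convexHull_inter {τ ρ : Finset V} (hτ : AffineIndependent ℝ ((↑) : τ → V))
    {x : V} (hx : ∀ f : V →ᵃ[ℝ] ℝ, (∀ t ∈ τ, 0 ≤ f t) → f x = 0 → ∀ t ∈ τ, f t = 0)
    (h : x ∈ convexHull ℝ ((τ ∩ ρ : Finset V) : Set V)) : τ ⊆ ρ := by
  obtain ⟨b, hb⟩ := exists_isBarycentric hτ
  intro v hv
  by_contra hvρ
  have h0 := hx (b v) (fun t ht => by rw [hb v hv t ht]; split_ifs <;> norm_num)
    (hb.eq_zero Finset.inter_subset_left h hv fun hv' => hvρ (Finset.mem_inter.1 hv').2) v hv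
  rw [hb v hv v hv] at h0
  simp at h0

lemma affineSpan_eq_of_card_eq {ρ σ : Finset V} (hρ : AffineIndependent ℝ ((↑) : ρ → V))
    (hσ : AffineIndependent ℝ ((↑) : σ → V))
    (hsub : (ρ : Set V) ⊆ affineSpan ℝ (σ : Set V)) (hcard : ρ.card = σ.card) :
    affineSpan ℝ (ρ : Set V) = affineSpan ℝ (σ : Set V) := by
  rcases σ.eq_empty_or_nonempty with rfl | hne
  · rw [Finset.card_empty, Finset.card_eq_zero] at hcard
    rw [hcard]
  have hle : affineSpan ℝ (ρ : Set V) ≤ affineSpan ℝ (σ : Set V) := affineSpan_le.2 hsub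
  have : FiniteDimensional ℝ (affineSpan ℝ (σ : Set V)).direction :=
    finiteDimensional_direction_affineSpan_of_finite ℝ σ.finite_toSet
  have h1 : Fintype.card σ = σ.card - 1 + 1 := by
    rw [Fintype.card_coe]; have := hne.card_pos; omega
  have h2 := hσ.finrank_vectorSpan h1
  rw [Subtype.range_coe_subtype] at h2
  have := hρ.affineSpan_eq_of_le_of_card_eq_finrank_add_one (sp := affineSpan ℝ (σ : Set V))
    (by simpa using hle)
    (by
      rw [direction_affineSpan, Fintype.card_coe, hcard, ← Fintype.card_coe, h1]
      simpa using h2.symm)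
  simpa using this

lemma finite_setOf_lineMap_mem {L : AffineSubspace ℝ V} {y z : V} (h : y ∉ L ∨ z ∉ L) :
    {ε : ℝ | AffineMap.lineMap y z ε ∈ L}.Finite := by
  refine Set.Subsingleton.finite fun ε hε δ hδ => ?_
  by_contra hne
  have key : ∀ r : ℝ, AffineMap.lineMap y z r ∈ L := fun r => by
    have := AffineMap.lineMap_mem ((r - ε) / (δ - ε)) hε hδ
    have hd : δ - ε ≠ 0 := sub_ne_zero.2 (Ne.symm hne)
    convert this using 1
    rw [← AffineMap.apply_lineMap]
    congr 1
    rw [AffineMap.lineMap_apply_ring']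
    field_simp
    ring
  rcases h with h | h
  · exact h (by simpa using key 0)
  · exact h (by simpa using key 1)

lemma Convex.exists_mem_forall_notMem {C : Set V} (hC : Convex ℝ C) (hne : C.Nonempty)
    (F : Finset (AffineSubspace ℝ V)) (hF : ∀ L ∈ F, ¬ C ⊆ L) :
    ∃ y ∈ C, ∀ L ∈ F, y ∉ L := by
  induction F using Finset.induction_on with
  | empty => exact ⟨hne.some, hne.some_mem, by simp⟩
  | insert L F _ ih =>
    obtain ⟨y, hy, hyF⟩ := ih fun L' hL' => hF L' (Finset.mem_insert_of_mem hL')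
    obtain ⟨z, hz, hzL⟩ := Set.not_subset.1 (hF L (Finset.mem_insert_self _ _))
    have hfin : (⋃ L' ∈ insert L F, {ε : ℝ | AffineMap.lineMap y z ε ∈ L'}).Finite := by
      refine Set.Finite.biUnion (Finset.finite_toSet (insert L F)) fun L' hL' => ?_
      rcases Finset.mem_insert.1 hL' with rfl | hL'
      · exact finite_setOf_lineMap_mem (Or.inr hzL)
      · exact finite_setOf_lineMap_mem (Or.inl (hyF L' hL'))
    obtain ⟨ε, hε, hεL⟩ := (Set.Icc_infinite (zero_lt_one' ℝ)).exists_notMem_finite hfin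
    refine ⟨AffineMap.lineMap y z ε, hC.lineMap_mem hy hz hε, fun L' hL' h => hεL ?_⟩
    exact Set.mem_biUnion (x := L') hL' h

end ConvexGeometry

section Topological

variable {V : Type*} [NormedAddCommGroup V] [NormedSpace ℝ V]

/-- A closed set containing a convex set up to finitely many proper affine subspaces contains
it entirely. -/
lemma Convex.subset_of_isClosed_of_forall_notMem {C K : Set V} (hC : Convex ℝ C)
    (hK : IsClosed K) (F : Finset (AffineSubspace ℝ V)) (hF : ∀ L ∈ F, ¬ C ⊆ L)
    (hcov : ∀ x ∈ C, (∀ L ∈ F, x ∉ L) → x ∈ K) : C ⊆ K := by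
  intro x hx
  obtain ⟨y, hy, hyF⟩ := hC.exists_mem_forall_notMem ⟨x, hx⟩ F hF
  have hfin : (⋃ L ∈ F, {ε : ℝ | AffineMap.lineMap x y ε ∈ L}).Finite :=
    Set.Finite.biUnion F.finite_toSet fun L hL => finite_setOf_lineMap_mem (Or.inr (hyF L hL))
  have htend : Filter.Tendsto (fun ε : ℝ => AffineMap.lineMap x y ε) (nhdsWithin 0 (Set.Ioi 0))
      (nhds x) := by
    have : Continuous fun ε : ℝ => (AffineMap.lineMap x y ε : V) :=
      AffineMap.lineMap_continuous
    simpa using (this.tendsto 0).mono_left nhdsWithin_le_nhds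
  refine hK.mem_of_tendsto htend ?_
  have h1 : ∀ᶠ ε : ℝ in nhdsWithin 0 (Set.Ioi 0),
      ε ∉ (⋃ L ∈ F, {ε : ℝ | AffineMap.lineMap x y ε ∈ L}) := by
    have := (hfin.subset (Set.sdiff_subset (t := {0}))).isClosed.isOpen_compl.mem_nhds
      (x := (0 : ℝ)) (by simp)
    filter_upwards [nhdsWithin_le_nhds this, self_mem_nhdsWithin] with ε h1 h2 h3
    exact h1 ⟨h3, ne_of_gt h2⟩
  filter_upwards [h1, Ioo_mem_nhdsGT (zero_lt_one' ℝ)] with ε h1 h2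
  exact hcov _ (hC.lineMap_mem hx hy ⟨h2.1.le, h2.2.le⟩) fun L hL h =>
    h1 (Set.mem_biUnion (x := L) hL h)

/-- Two `n`-simplices contain points joined by a segment avoiding the affine spans of finitely
many simplices of codimension at least two. -/
lemma exists_segment_forall_notMem_affineSpan {ρ₁ ρ₂ : Finset V} {n : ℕ}
    (h₁ : AffineIndependent ℝ ((↑) : ρ₁ → V)) (h₂ : AffineIndependent ℝ ((↑) : ρ₂ → V))
    (hc₁ : ρ₁.card = n + 1) (hc₂ : ρ₂.card = n + 1) (F : Finset (Finset V))
    (hF : ∀ τ ∈ F, τ.card < n) :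
    ∃ p ∈ convexHull ℝ (ρ₁ : Set V), ∃ q ∈ convexHull ℝ (ρ₂ : Set V),
      ∀ z ∈ segment ℝ p q, ∀ τ ∈ F, z ∉ affineSpan ℝ (τ : Set V) := by
  have hne : ∀ ρ : Finset V, ρ.card = n + 1 → (convexHull ℝ (ρ : Set V)).Nonempty := fun ρ hρ =>
    convexHull_nonempty_iff.2 (Finset.coe_nonempty.2 (Finset.card_pos.1 (by omega)))
  have hnot : ∀ ρ : Finset V, AffineIndependent ℝ ((↑) : ρ → V) → ρ.card = n + 1 →
      ∀ τ : Finset V, τ.card ≤ n →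
        ¬ convexHull ℝ (ρ : Set V) ⊆ affineSpan ℝ (τ : Set V) := by
    intro ρ hi hc τ hτ hsub
    have := hi.card_le_card_of_subset_affineSpan ((subset_convexHull ℝ _).trans hsub)
    omega
  obtain ⟨p, hp, hpF⟩ := (convex_convexHull ℝ (ρ₁ : Set V)).exists_mem_forall_notMem
    (hne ρ₁ hc₁) (F.image fun τ : Finset V => affineSpan ℝ (τ : Set V)) (by
      intro L hL
      obtain ⟨τ, hτ, rfl⟩ := Finset.mem_image.1 hL
      exact hnot ρ₁ h₁ hc₁ τ (hF τ hτ).le)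
  obtain ⟨q, hq, hqF⟩ := (convex_convexHull ℝ (ρ₂ : Set V)).exists_mem_forall_notMem
    (hne ρ₂ hc₂) (F.image fun τ : Finset V => affineSpan ℝ ((insert p τ : Finset V) : Set V)) (by
      intro L hL
      obtain ⟨τ, hτ, rfl⟩ := Finset.mem_image.1 hL
      exact hnot ρ₂ h₂ hc₂ _ ((Finset.card_insert_le _ _).trans (hF τ hτ)))
  refine ⟨p, hp, q, hq, fun z hz τ hτ hzτ => ?_⟩
  have hpτ : p ∉ affineSpan ℝ (τ : Set V) := hpF _ (Finset.mem_image_of_mem _ hτ)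
  have hqτ := hqF _ (Finset.mem_image_of_mem _ hτ)
  rw [segment_eq_image_lineMap] at hz
  obtain ⟨ε, hε, rfl⟩ := hz
  have hε0 : ε ≠ 0 := by
    rintro rfl
    exact hpτ (by simpa using hzτ)
  have hp' : p ∈ affineSpan ℝ ((insert p τ : Finset V) : Set V) :=
    subset_affineSpan _ _ (by simp)
  have hz' := affineSpan_mono ℝ
    (Finset.coe_subset.2 (Finset.subset_insert p τ)) hzτ
  have := AffineMap.lineMap_mem ε⁻¹ hp' hz'
  rw [AffineMap.lineMap_lineMap_right, inv_mul_cancel₀ hε0, AffineMap.lineMap_apply_one] at this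
  exact hqτ this

end Topological

namespace GeomComplex

variable {V : Type*} [NormedAddCommGroup V] [NormedSpace ℝ V] {S S' : GeomComplex V} {n : ℕ}

lemma card_le_of_convexHull_subset {σ τ : Finset V} {K : GeomComplex V} (hτ : τ ∈ K.faces)
    (h : convexHull ℝ (τ : Set V) ⊆ convexHull ℝ (σ : Set V)) : τ.card ≤ σ.card :=
  (K.indep τ hτ).card_le_card_of_subset_affineSpan
    ((subset_convexHull ℝ _).trans (h.trans (convexHull_subset_affineSpan _)))

lemma affineSpan_eq_of_convexHull_subset {σ ρ : Finset V} (hσ : σ ∈ S.faces) (hρ : ρ ∈ S'.faces)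
    (h : convexHull ℝ (ρ : Set V) ⊆ convexHull ℝ (σ : Set V)) (hc : ρ.card = σ.card) :
    affineSpan ℝ (ρ : Set V) = affineSpan ℝ (σ : Set V) :=
  affineSpan_eq_of_card_eq (S'.indep ρ hρ) (S.indep σ hσ)
    ((subset_convexHull ℝ _).trans (h.trans (convexHull_subset_affineSpan _))) hc

/-- Each simplex of `S` is covered by the simplices of a subdivision of the same dimension. -/
lemma exists_mem_convexHull_card_eq (hsub : IsSubdivision S' S) {σ : Finset V} (hσ : σ ∈ S.faces)
    {x : V} (hx : x ∈ convexHull ℝ (σ : Set V)) :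
    ∃ ρ ∈ S'.faces, ρ.card = σ.card ∧ convexHull ℝ (ρ : Set V) ⊆ convexHull ℝ (σ : Set V) ∧
      x ∈ convexHull ℝ (ρ : Set V) := by
  set R := S'.faces.filter fun ρ : Finset V => ρ.card = σ.card ∧
    convexHull ℝ (ρ : Set V) ⊆ convexHull ℝ (σ : Set V)
  have hcl : IsClosed (⋃ ρ ∈ R, convexHull ℝ (ρ : Set V)) :=
    isClosed_biUnion_finset fun ρ _ => ρ.finite_toSet.isClosed_convexHull ℝ
  have hcov := (convex_convexHull ℝ (σ : Set V)).subset_of_isClosed_of_forall_notMem hcl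
    ((S'.faces.filter fun ρ : Finset V => ρ.card < σ.card).image
      fun ρ : Finset V => affineSpan ℝ (ρ : Set V))
    (by
      intro L hL hsubL
      obtain ⟨ρ, hρ, rfl⟩ := Finset.mem_image.1 hL
      have := (S.indep σ hσ).card_le_card_of_subset_affineSpan
        ((subset_convexHull ℝ _).trans hsubL)
      have := (Finset.mem_filter.1 hρ).2
      omega)
    (by
      intro y hy hyL
      obtain ⟨ρ, hρ, hρσ, hyρ⟩ : ∃ ρ ∈ S'.faces,
          convexHull ℝ (ρ : Set V) ⊆ convexHull ℝ (σ : Set V) ∧ y ∈ convexHull ℝ (ρ : Set V) := by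
        rw [hsub.2 σ hσ] at hy
        simpa [and_assoc] using hy
      refine Set.mem_iUnion₂.2 ⟨ρ, Finset.mem_filter.2 ⟨hρ, ?_, hρσ⟩, hyρ⟩
      refine (card_le_of_convexHull_subset hρ hρσ).antisymm (not_lt.1 fun hlt => ?_)
      exact hyL _ (Finset.mem_image_of_mem _ (Finset.mem_filter.2 ⟨hρ, hlt⟩))
        (convexHull_subset_affineSpan _ hyρ))
  obtain ⟨ρ, hρ, hxρ⟩ := Set.mem_iUnion₂.1 (hcov hx)
  obtain ⟨hρ, hc, hρσ⟩ := Finset.mem_filter.1 hρ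
  exact ⟨ρ, hρ, hc, hρσ, hxρ⟩

lemma exists_superset_card_eq (hsub : IsSubdivision S' S) {σ τ : Finset V} (hσ : σ ∈ S.faces)
    (hτ : τ ∈ S'.faces) (hτσ : convexHull ℝ (τ : Set V) ⊆ convexHull ℝ (σ : Set V)) :
    ∃ ρ ∈ S'.faces, ρ.card = σ.card ∧ convexHull ℝ (ρ : Set V) ⊆ convexHull ℝ (σ : Set V) ∧
      τ ⊆ ρ := by
  obtain ⟨x, hx, hxf⟩ := exists_mem_convexHull_forall_affineMap (S'.nonempty_of_mem τ hτ)
  obtain ⟨ρ, hρ, hc, hρσ, hxρ⟩ := exists_mem_convexHull_card_eq hsub hσ (hτσ hx)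
  refine ⟨ρ, hρ, hc, hρσ, subset_of_mem_convexHull_inter (S'.indep τ hτ) hxf ?_⟩
  rw [← S'.inter_face τ hτ ρ hρ]
  exact ⟨hx, hxρ⟩

lemma exists_convexHull_subset (hS : IsPseudoManifold S n) (hsub : IsSubdivision S' S)
    {τ : Finset V} (hτ : τ ∈ S'.faces) :
    ∃ σ ∈ S.faces, σ.card = n + 1 ∧ convexHull ℝ (τ : Set V) ⊆ convexHull ℝ (σ : Set V) := by
  obtain ⟨σ₀, hσ₀, h⟩ := hsub.1 τ hτ
  obtain ⟨σ, hσ, hc, hle⟩ := hS.2.2.2 σ₀ hσ₀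
  exact ⟨σ, hσ, hc, h.trans (convexHull_mono (Finset.coe_subset.2 hle))⟩

lemma hasDim_of_subdivision (hS : IsPseudoManifold S n) (hsub : IsSubdivision S' S) :
    S'.HasDim n := by
  refine ⟨?_, fun τ hτ => ?_⟩
  · obtain ⟨σ, hσ, hc⟩ := hS.1.1
    obtain ⟨v, hv⟩ := S.nonempty_of_mem σ hσ
    obtain ⟨ρ, hρ, hρc, -⟩ :=
      exists_mem_convexHull_card_eq hsub hσ (subset_convexHull ℝ _ (Finset.mem_coe.2 hv))
    exact ⟨ρ, hρ, hρc.trans hc⟩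
  · obtain ⟨σ, hσ, hc, h⟩ := exists_convexHull_subset hS hsub hτ
    exact hc ▸ card_le_of_convexHull_subset hτ h

lemma dimHomogeneous_of_subdivision (hS : IsPseudoManifold S n) (hsub : IsSubdivision S' S) :
    DimHomogeneous S' n := by
  intro τ hτ
  obtain ⟨σ, hσ, hc, h⟩ := exists_convexHull_subset hS hsub hτ
  obtain ⟨ρ, hρ, hρc, -, hτρ⟩ := exists_superset_card_eq hsub hσ hτ h
  exact ⟨ρ, hρ, hρc.trans hc, hτρ⟩

/-- Two `n`-simplices of `S` sharing an `(n-1)`-face. -/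
def FacetAdj (S : GeomComplex V) (n : ℕ) (ρ₁ ρ₂ : Finset V) : Prop :=
  (ρ₁ ∈ S.faces ∧ ρ₁.card = n + 1) ∧ (ρ₂ ∈ S.faces ∧ ρ₂.card = n + 1) ∧
    ∃ τ ∈ S.faces, τ.card = n ∧ τ ⊆ ρ₁ ∧ τ ⊆ ρ₂

lemma exists_chain_of_reflTransGen {ρ₁ ρ₂ : Finset V} (hρ₁ : ρ₁ ∈ S.faces)
    (hc : ρ₁.card = n + 1) (h : Relation.ReflTransGen (S.FacetAdj n) ρ₁ ρ₂) :
    ∃ (k : ℕ) (c : ℕ → Finset V), c 0 = ρ₁ ∧ c k = ρ₂ ∧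
      (∀ i ≤ k, c i ∈ S.faces ∧ (c i).card = n + 1) ∧
      ∀ i < k, ∃ τ ∈ S.faces, τ.card = n ∧ τ ⊆ c i ∧ τ ⊆ c (i + 1) := by
  induction h with
  | refl => exact ⟨0, fun _ => ρ₁, rfl, rfl, fun _ _ => ⟨hρ₁, hc⟩, fun i hi => by omega⟩
  | @tail ρ ρ' _ hadj ih =>
    obtain ⟨k, c, h0, hk, hf, hτ⟩ := ih
    refine ⟨k + 1, fun i => if i ≤ k then c i else ρ', by simp [h0], by simp, fun i hi => ?_,
      fun i hi => ?_⟩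
    · by_cases hik : i ≤ k
      · simpa [hik] using hf i hik
      · simpa [hik] using hadj.2.1
    · rcases (Nat.lt_succ_iff_lt_or_eq.1 hi) with hik | rfl
      · simpa [hik.le, Nat.succ_le_of_lt hik] using hτ i hik
      · simpa [hk] using hadj.2.2

lemma reflTransGen_facetAdj_of_convexHull_subset (hsub : IsSubdivision S' S) {σ : Finset V}
    (hσ : σ ∈ S.faces) (hσc : σ.card = n + 1) {ρ₁ ρ₂ : Finset V} (hρ₁ : ρ₁ ∈ S'.faces)
    (hρ₂ : ρ₂ ∈ S'.faces) (hc₁ : ρ₁.card = n + 1) (hc₂ : ρ₂.card = n + 1)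
    (h₁ : convexHull ℝ (ρ₁ : Set V) ⊆ convexHull ℝ (σ : Set V))
    (h₂ : convexHull ℝ (ρ₂ : Set V) ⊆ convexHull ℝ (σ : Set V)) :
    Relation.ReflTransGen (S'.FacetAdj n) ρ₁ ρ₂ := by
  by_contra hcon
  obtain ⟨p, hp, q, hq, hpq⟩ := exists_segment_forall_notMem_affineSpan
    (S'.indep ρ₁ hρ₁) (S'.indep ρ₂ hρ₂) hc₁ hc₂ (S'.faces.filter fun τ : Finset V => τ.card < n)
    fun τ hτ => (Finset.mem_filter.1 hτ).2
  set A := S'.faces.filter fun ρ : Finset V =>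
    ρ.card = n + 1 ∧ Relation.ReflTransGen (S'.FacetAdj n) ρ₁ ρ
  set B := S'.faces.filter fun ρ : Finset V =>
    ρ.card = n + 1 ∧ ¬ Relation.ReflTransGen (S'.FacetAdj n) ρ₁ ρ
  have hcl : ∀ R : Finset (Finset V), IsClosed (⋃ ρ ∈ R, convexHull ℝ (ρ : Set V)) := fun R =>
    isClosed_biUnion_finset fun ρ _ => ρ.finite_toSet.isClosed_convexHull ℝ
  have hseg : segment ℝ p q ⊆ convexHull ℝ (σ : Set V) :=
    (convex_convexHull ℝ _).segment_subset (h₁ hp) (h₂ hq)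
  obtain ⟨z, hz, hzA, hzB⟩ := isPreconnected_closed_iff.1
    (convex_segment p q).isPreconnected _ _ (hcl A) (hcl B)
    (by
      intro z hz
      obtain ⟨ρ, hρ, hρc, -, hzρ⟩ := exists_mem_convexHull_card_eq hsub hσ (hseg hz)
      by_cases h : Relation.ReflTransGen (S'.FacetAdj n) ρ₁ ρ
      · exact Or.inl (Set.mem_iUnion₂.2
          ⟨ρ, Finset.mem_filter.2 ⟨hρ, hρc.trans hσc, h⟩, hzρ⟩)
      · exact Or.inr (Set.mem_iUnion₂.2
          ⟨ρ, Finset.mem_filter.2 ⟨hρ, hρc.trans hσc, h⟩, hzρ⟩))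
    ⟨p, left_mem_segment ℝ p q, Set.mem_iUnion₂.2
      ⟨ρ₁, Finset.mem_filter.2 ⟨hρ₁, hc₁, Relation.ReflTransGen.refl⟩, hp⟩⟩
    ⟨q, right_mem_segment ℝ p q, Set.mem_iUnion₂.2
      ⟨ρ₂, Finset.mem_filter.2 ⟨hρ₂, hc₂, hcon⟩, hq⟩⟩
  obtain ⟨ρ, hρ, hzρ⟩ := Set.mem_iUnion₂.1 hzA
  obtain ⟨ρ', hρ', hzρ'⟩ := Set.mem_iUnion₂.1 hzB
  obtain ⟨hρ, hc, hr⟩ := Finset.mem_filter.1 hρ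
  obtain ⟨hρ', hc', hr'⟩ := Finset.mem_filter.1 hρ'
  have hzi : z ∈ convexHull ℝ ((ρ ∩ ρ' : Finset V) : Set V) := by
    rw [← S'.inter_face ρ hρ ρ' hρ']
    exact ⟨hzρ, hzρ'⟩
  have hne : (ρ ∩ ρ').Nonempty := Finset.coe_nonempty.1 (convexHull_nonempty_iff.1 ⟨z, hzi⟩)
  have hface : ρ ∩ ρ' ∈ S'.faces := S'.down_closed ρ hρ _ Finset.inter_subset_left hne
  have hle : n ≤ (ρ ∩ ρ').card := by
    by_contra hlt
    exact hpq z hz _ (Finset.mem_filter.2 ⟨hface, not_le.1 hlt⟩)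
      (convexHull_subset_affineSpan _ hzi)
  rcases hle.eq_or_lt with heq | hlt
  · exact hr' (hr.tail ⟨⟨hρ, hc⟩, ⟨hρ', hc'⟩, ρ ∩ ρ', hface, heq.symm,
      Finset.inter_subset_left, Finset.inter_subset_right⟩)
  · have e1 := Finset.eq_of_subset_of_card_le (Finset.inter_subset_left (s₁ := ρ) (s₂ := ρ'))
      (by omega)
    have e2 := Finset.eq_of_subset_of_card_le (Finset.inter_subset_right (s₁ := ρ) (s₂ := ρ'))
      (by omega)
    exact hr' (e2 ▸ e1.symm ▸ hr)

lemma stronglyConnected_of_subdivision (hS : IsPseudoManifold S n) (hsub : IsSubdivision S' S) :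
    StronglyConnected S' n := by
  intro ρ hρ hρc ρ' hρ' hρc'
  refine exists_chain_of_reflTransGen hρ hρc ?_
  obtain ⟨σ, hσ, hσc, hle⟩ := exists_convexHull_subset hS hsub hρ
  obtain ⟨σ', hσ', hσc', hle'⟩ := exists_convexHull_subset hS hsub hρ'
  obtain ⟨k, c, rfl, rfl, hf, hadj⟩ := hS.2.2.1 σ hσ hσc σ' hσ' hσc'
  clear hσ hσc hσ' hσc'
  induction k generalizing ρ' with
  | zero =>
    exact reflTransGen_facetAdj_of_convexHull_subset hsub (hf 0 le_rfl).1 (hf 0 le_rfl).2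
      hρ hρ' hρc hρc' hle hle'
  | succ k ih =>
    obtain ⟨τ, hτ, hτc, hτ1, hτ2⟩ := hadj k (Nat.lt_succ_self k)
    obtain ⟨v, hv⟩ := S.nonempty_of_mem τ hτ
    obtain ⟨τ', hτ', hτc', hτle, -⟩ :=
      exists_mem_convexHull_card_eq hsub hτ (subset_convexHull ℝ _ (Finset.mem_coe.2 hv))
    obtain ⟨ρ₁, hρ₁, hc₁, hle₁, hsub₁⟩ := exists_superset_card_eq hsub (hf k (by omega)).1 hτ'
      (hτle.trans (convexHull_mono (Finset.coe_subset.2 hτ1)))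
    obtain ⟨ρ₂, hρ₂, hc₂, hle₂, hsub₂⟩ := exists_superset_card_eq hsub (hf (k + 1) le_rfl).1 hτ'
      (hτle.trans (convexHull_mono (Finset.coe_subset.2 hτ2)))
    rw [(hf k (by omega)).2] at hc₁
    rw [(hf (k + 1) le_rfl).2] at hc₂
    refine ((ih ρ₁ hρ₁ hc₁ hle₁ (fun i hi => hf i (by omega))
      (fun i hi => hadj i (by omega))).tail
        ⟨⟨hρ₁, hc₁⟩, ⟨hρ₂, hc₂⟩, τ', hτ', hτc'.trans hτc, hsub₁, hsub₂⟩).trans ?_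
    exact reflTransGen_facetAdj_of_convexHull_subset hsub (hf (k + 1) le_rfl).1
      (hf (k + 1) le_rfl).2 hρ₂ hρ' hc₂ hρc' hle₂ hle'

/-- Two simplices with a common facet `τ`, lying in the same affine space on the same side of
`τ`, coincide. -/
lemma eq_of_same_side {τ : Finset V} (hτ : τ ∈ S.faces) {v₁ v₂ : V}
    (h₁ : insert v₁ τ ∈ S.faces) (h₂ : insert v₂ τ ∈ S.faces) (hv₁ : v₁ ∉ τ)
    (hspan : v₂ ∈ affineSpan ℝ ((insert v₁ τ : Finset V) : Set V)) (f : V →ᵃ[ℝ] ℝ)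
    (hf : ∀ t ∈ τ, f t = 0) (hf₁ : 0 < f v₁) (hf₂ : 0 < f v₂) : v₁ = v₂ := by
  by_contra hne
  obtain ⟨x, hx, hxf⟩ := exists_mem_convexHull_forall_affineMap (S.nonempty_of_mem τ hτ)
  obtain ⟨b, hb⟩ := exists_isBarycentric (S.indep _ h₁)
  have hm₁ : v₁ ∈ insert v₁ τ := Finset.mem_insert_self _ _
  have hsub₁ : τ ⊆ insert v₁ τ := Finset.subset_insert _ _
  have hx₁ : x ∈ convexHull ℝ ((insert v₁ τ : Finset V) : Set V) :=
    convexHull_mono (Finset.coe_subset.2 hsub₁) hx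
  have hbx : ∀ t ∈ τ, 0 < b t x := by
    intro t ht
    refine (hb.nonneg hx₁ (hsub₁ ht)).lt_of_ne' fun h0 => ?_
    have := hxf (b t) (fun s hs => by
      rw [hb t (hsub₁ ht) s (hsub₁ hs)]; split_ifs <;> norm_num) h0 t ht
    rw [hb t (hsub₁ ht) t (hsub₁ ht)] at this
    simp at this
  have hbv : 0 < b v₁ v₂ := by
    have := hb.map_eq_sum f hspan
    rw [Finset.sum_insert hv₁, Finset.sum_eq_zero fun t ht => by rw [hf t ht, smul_zero],
      add_zero, smul_eq_mul] at this
    exact pos_of_mul_pos_left (this ▸ hf₂) hf₁.le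
  have hev : ∀ᶠ ε : ℝ in nhdsWithin 0 (Set.Ioi 0), ∀ t ∈ τ,
      0 < b t (AffineMap.lineMap x v₂ ε) := by
    refine (Finset.eventually_all τ).2 fun t ht => ?_
    have hcont : Continuous fun ε : ℝ => b t (AffineMap.lineMap x v₂ ε) := by
      simp only [AffineMap.apply_lineMap]
      exact AffineMap.lineMap_continuous
    refine nhdsWithin_le_nhds (hcont.continuousAt.eventually (lt_mem_nhds ?_))
    simpa using hbx t ht
  obtain ⟨ε, hε, hε01⟩ := (hev.and (Ioo_mem_nhdsGT (zero_lt_one' ℝ))).exists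
  set y : V := AffineMap.lineMap x v₂ ε with hy
  have hfx : f x = 0 := affineMap_eq_zero_of_mem_convexHull f hf hx
  have hy₁ : y ∈ convexHull ℝ ((insert v₁ τ : Finset V) : Set V) := by
    refine hb.mem_convexHull (AffineMap.lineMap_mem ε (convexHull_subset_affineSpan _ hx₁) hspan)
      subset_rfl (fun v hv => ?_) fun v hv hv' => absurd hv hv'
    rcases Finset.mem_insert.1 hv with rfl | hv
    · rw [hy, AffineMap.apply_lineMap, AffineMap.lineMap_apply_ring', hb.eq_zero hsub₁ hx hm₁ hv₁]
      have := mul_pos hε01.1 hbv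
      simp only [sub_zero, add_zero]
      exact this.le
    · exact (hε v hv).le
  have hy₂ : y ∈ convexHull ℝ ((insert v₂ τ : Finset V) : Set V) :=
    (convex_convexHull ℝ _).lineMap_mem
      (convexHull_mono (Finset.coe_subset.2 (Finset.subset_insert _ _)) hx)
      (subset_convexHull ℝ _ (by simp)) ⟨hε01.1.le, hε01.2.le⟩
  have hyi : y ∈ convexHull ℝ ((insert v₁ τ ∩ insert v₂ τ : Finset V) : Set V) := by
    rw [← S.inter_face _ h₁ _ h₂]
    exact ⟨hy₁, hy₂⟩
  have hfy : f y = 0 := by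
    refine affineMap_eq_zero_of_mem_convexHull f (fun v hv => hf v ?_) hyi
    obtain ⟨ha, ha'⟩ := Finset.mem_inter.1 (Finset.mem_coe.1 hv)
    rcases Finset.mem_insert.1 ha with rfl | ha
    · exact (Finset.mem_insert.1 ha').resolve_left hne
    · exact ha
  rw [hy, AffineMap.apply_lineMap, AffineMap.lineMap_apply_ring', hfx] at hfy
  have := mul_pos hε01.1 hf₂
  simp only [sub_zero, add_zero] at hfy
  exact this.ne' hfy

/-- The carrier of a simplex `τ` of a subdivision of `S`: the smallest simplex of `S`
containing `τ`. -/
lemma exists_carrier (hS : IsPseudoManifold S n) (hsub : IsSubdivision S' S)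
    {τ : Finset V} (hτ : τ ∈ S'.faces) :
    ∃ G ∈ S.faces, convexHull ℝ (τ : Set V) ⊆ convexHull ℝ (G : Set V) ∧
      ∀ σ ∈ S.faces, convexHull ℝ (τ : Set V) ⊆ convexHull ℝ (σ : Set V) → G ⊆ σ := by
  obtain ⟨G, hG, hmin⟩ := Finset.exists_min_image
    (S.faces.filter fun σ : Finset V => convexHull ℝ (τ : Set V) ⊆ convexHull ℝ (σ : Set V))
    Finset.card (by
      obtain ⟨σ, hσ, -, h⟩ := exists_convexHull_subset hS hsub hτ
      exact ⟨σ, Finset.mem_filter.2 ⟨hσ, h⟩⟩)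
  obtain ⟨hG, hτG⟩ := Finset.mem_filter.1 hG
  refine ⟨G, hG, hτG, fun σ hσ hτσ => ?_⟩
  have hi : convexHull ℝ (τ : Set V) ⊆ convexHull ℝ ((G ∩ σ : Finset V) : Set V) := by
    rw [← S.inter_face G hG σ hσ]
    exact Set.subset_inter hτG hτσ
  have hne : (G ∩ σ).Nonempty := Finset.coe_nonempty.1 (convexHull_nonempty_iff.1
    ((convexHull_nonempty_iff.2 (Finset.coe_nonempty.2 (S'.nonempty_of_mem τ hτ))).mono hi))
  have := hmin _ (Finset.mem_filter.2
    ⟨S.down_closed G hG _ Finset.inter_subset_left hne, hi⟩)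
  exact Finset.inter_eq_left.1 (Finset.eq_of_subset_of_card_le Finset.inter_subset_left this)

lemma nonBranching_of_subdivision (hS : IsPseudoManifold S n) (hsub : IsSubdivision S' S) :
    NonBranching S' n := by
  intro τ hτ hτc
  set F := S'.faces.filter fun ρ : Finset V => τ ⊆ ρ ∧ ρ.card = n + 1
  suffices h : 1 ≤ F.card ∧ F.card ≤ 2 by omega
  refine ⟨?_, ?_⟩
  · obtain ⟨ρ, hρ, hc, hle⟩ := dimHomogeneous_of_subdivision hS hsub τ hτ
    exact Finset.card_pos.2 ⟨ρ, Finset.mem_filter.2 ⟨hρ, hle, hc⟩⟩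
  obtain ⟨G, hG, hτG, hmin⟩ := exists_carrier hS hsub hτ
  have hins : ∀ ρ ∈ F, ∃ v, v ∉ τ ∧ ρ = insert v τ := fun ρ hρ => by
    obtain ⟨-, hle, hc⟩ := Finset.mem_filter.1 hρ
    obtain ⟨v, hv, rfl⟩ := (Finset.covBy_iff_exists_insert.1
      (Finset.covBy_iff_card_sdiff_eq_one.2 ⟨hle, by rw [Finset.card_sdiff_of_subset hle]; omega⟩))
    exact ⟨v, hv, rfl⟩
  have hface : ∀ ρ ∈ F, ρ ∈ S'.faces ∧ ρ.card = n + 1 := fun ρ hρ =>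
    ⟨(Finset.mem_filter.1 hρ).1, (Finset.mem_filter.1 hρ).2.2⟩
  have hex : ∀ ρ ∈ F, ∃ σ ∈ S.faces, σ.card = n + 1 ∧
      convexHull ℝ (ρ : Set V) ⊆ convexHull ℝ (σ : Set V) ∧ G ⊆ σ := fun ρ hρ => by
    obtain ⟨hρ, hle, -⟩ := Finset.mem_filter.1 hρ
    obtain ⟨σ, hσ, hc, h⟩ := exists_convexHull_subset hS hsub hρ
    exact ⟨σ, hσ, hc, h, hmin σ hσ ((convexHull_mono (Finset.coe_subset.2 hle)).trans h)⟩
  have hspan : ∀ σ ∈ S.faces, σ.card = n + 1 → ∀ v w,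
      insert v τ ∈ F → insert w τ ∈ F →
      convexHull ℝ ((insert v τ : Finset V) : Set V) ⊆ convexHull ℝ (σ : Set V) →
      convexHull ℝ ((insert w τ : Finset V) : Set V) ⊆ convexHull ℝ (σ : Set V) →
      w ∈ affineSpan ℝ ((insert v τ : Finset V) : Set V) := by
    intro σ hσ hσc v w hv hw hvσ hwσ
    rw [affineSpan_eq_of_convexHull_subset hσ (hface _ hv).1 hvσ ((hface _ hv).2.trans hσc.symm)]
    exact convexHull_subset_affineSpan _ (hwσ (subset_convexHull ℝ _ (by simp)))
  have hGle : G.card ≤ n + 1 := hS.1.2 G hG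
  have hGge : n ≤ G.card := hτc ▸ card_le_of_convexHull_subset hτ hτG
  rcases hGge.eq_or_lt with hGc | hGc
  · choose! s hs using hex
    have hcard : F.card ≤ (S.faces.filter fun σ : Finset V => G ⊆ σ ∧ σ.card = n + 1).card := by
      refine Finset.card_le_card_of_injOn s (fun ρ hρ => ?_) fun ρ₁ hρ₁ ρ₂ hρ₂ heq => ?_
      · have := hs ρ hρ
        exact Finset.mem_coe.2 (Finset.mem_filter.2 ⟨this.1, this.2.2.2, this.2.1⟩)
      · obtain ⟨hσ, hσc, h₁, hGσ⟩ := hs ρ₁ hρ₁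
        obtain ⟨-, -, h₂, -⟩ := hs ρ₂ hρ₂
        rw [← heq] at h₂
        generalize s ρ₁ = σ at *
        obtain ⟨v₁, hv₁, rfl⟩ := hins ρ₁ hρ₁
        obtain ⟨v₂, hv₂, rfl⟩ := hins ρ₂ hρ₂
        obtain ⟨w, hw, rfl⟩ := (Finset.covBy_iff_exists_insert.1
          (Finset.covBy_iff_card_sdiff_eq_one.2
            ⟨hGσ, by rw [Finset.card_sdiff_of_subset hGσ]; omega⟩))
        obtain ⟨b, hb⟩ := exists_isBarycentric (S.indep _ hσ)
        have hmw : w ∈ insert w G := Finset.mem_insert_self _ _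
        have hpos : ∀ v, insert v τ ∈ F →
            convexHull ℝ ((insert v τ : Finset V) : Set V) ⊆
              convexHull ℝ ((insert w G : Finset V) : Set V) → 0 < b w v := by
          intro v hv hvσ
          have hvm := hvσ (subset_convexHull ℝ _ (by simp : v ∈ _))
          refine (hb.nonneg hvm hmw).lt_of_ne' fun h0 => ?_
          have hvG : v ∈ convexHull ℝ (G : Set V) := by
            refine hb.mem_convexHull (convexHull_subset_affineSpan _ hvm)
              (Finset.subset_insert _ _)
              (fun u hu => hb.nonneg hvm (Finset.mem_insert_of_mem hu)) fun u hu hu' => ?_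
            rw [(Finset.mem_insert.1 hu).resolve_right hu', h0]
          have hle : convexHull ℝ ((insert v τ : Finset V) : Set V) ⊆
              convexHull ℝ (G : Set V) := by
            refine convexHull_min ?_ (convex_convexHull ℝ _)
            rw [Finset.coe_insert]
            exact Set.insert_subset hvG ((subset_convexHull ℝ _).trans hτG)
          have := card_le_of_convexHull_subset (hface _ hv).1 hle
          have := (hface _ hv).2
          omega
        rw [eq_of_same_side hτ (hface _ hρ₁).1 (hface _ hρ₂).1 hv₁
          (hspan _ hσ hσc v₁ v₂ hρ₁ hρ₂ h₁ h₂) (b w)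
          (fun t ht => hb.eq_zero (Finset.subset_insert _ _)
            (hτG (subset_convexHull ℝ _ (Finset.mem_coe.2 ht))) hmw hw)
          (hpos v₁ hρ₁ h₁) (hpos v₂ hρ₂ h₂)]
    have := hS.2.1 G hG hGc.symm
    omega
  · have hle : ∀ ρ ∈ F, convexHull ℝ (ρ : Set V) ⊆ convexHull ℝ (G : Set V) := fun ρ hρ => by
      obtain ⟨σ, hσ, hσc, h, hGσ⟩ := hex ρ hρ
      rwa [Finset.eq_of_subset_of_card_le hGσ (by omega)]
    have hGn : G.card = n + 1 := by omega
    by_contra hlt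
    obtain ⟨ρ₁, hρ₁, ρ₂, hρ₂, ρ₃, hρ₃, h₁₂, h₁₃, h₂₃⟩ := Finset.two_lt_card.1 (not_le.1 hlt)
    obtain ⟨v₁, hv₁, rfl⟩ := hins ρ₁ hρ₁
    obtain ⟨v₂, hv₂, rfl⟩ := hins ρ₂ hρ₂
    obtain ⟨v₃, hv₃, rfl⟩ := hins ρ₃ hρ₃
    obtain ⟨b, hb⟩ := exists_isBarycentric (S'.indep _ (hface _ hρ₁).1)
    have hm₁ : v₁ ∈ insert v₁ τ := Finset.mem_insert_self _ _
    have hsub₁ : τ ⊆ insert v₁ τ := Finset.subset_insert _ _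
    have hbτ : ∀ t ∈ τ, b v₁ t = 0 := fun t ht =>
      hb.eq_zero hsub₁ (subset_convexHull ℝ _ (Finset.mem_coe.2 ht)) hm₁ hv₁
    have hb₁ : b v₁ v₁ = 1 := by rw [hb v₁ hm₁ v₁ hm₁, if_pos rfl]
    have hneg : ∀ v, insert v τ ∈ F → insert v₁ τ ≠ insert v τ → b v₁ v < 0 := by
      intro v hv hne
      have hvs := hspan G hG hGn v₁ v hρ₁ hv (hle _ hρ₁) (hle _ hv)
      refine lt_of_le_of_ne (not_lt.1 fun hpos => hne ?_) fun h0 => ?_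
      · rw [eq_of_same_side hτ (hface _ hρ₁).1 (hface _ hv).1 hv₁ hvs (b v₁) hbτ
          (hb₁ ▸ one_pos) hpos]
      · have hvτ : v ∈ affineSpan ℝ (τ : Set V) := by
          have h1 := hb.sum_eq_one hvs
          have h2 := hb.sum_smul_eq hvs
          rw [Finset.sum_insert hv₁, h0, zero_add] at h1
          rw [Finset.sum_insert hv₁, h0, zero_smul, zero_add] at h2
          have h3 := affineCombination_mem_affineSpan_image h1 (s' := (τ : Set V))
            (fun i hi hi' => absurd hi hi') id
          rw [τ.affineCombination_eq_linear_combination _ _ h1] at h3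
          simpa [h2] using h3
        have := (S'.indep _ (hface _ hv).1).card_le_card_of_subset_affineSpan (t := τ) (by
          rw [Finset.coe_insert]
          exact Set.insert_subset hvτ (subset_affineSpan _ _))
        have := (hface _ hv).2
        omega
    refine h₂₃ ?_
    rw [eq_of_same_side hτ (hface _ hρ₂).1 (hface _ hρ₃).1 hv₂
      (hspan G hG hGn v₂ v₃ hρ₂ hρ₃ (hle _ hρ₂) (hle _ hρ₃)) (-b v₁)
      (fun t ht => by simp [hbτ t ht])
      (by simpa using hneg v₂ hρ₂ h₁₂) (by simpa using hneg v₃ hρ₃ h₁₃)]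

end GeomComplex

/-- Every subdivision of an `n`-dimensional pseudo-manifold is an `n`-dimensional
pseudo-manifold. -/
theorem isPseudoManifold_of_subdivision (d n : ℕ)
    (S S' : GeomComplex (EuclideanSpace ℝ (Fin d)))
    (hS : IsPseudoManifold S n) (hsub : IsSubdivision S' S) :
    IsPseudoManifold S' n := by
  exact ⟨GeomComplex.hasDim_of_subdivision hS hsub,
    GeomComplex.nonBranching_of_subdivision hS hsub,
    GeomComplex.stronglyConnected_of_subdivision hS hsub,
    GeomComplex.dimHomogeneous_of_subdivision hS hsub⟩
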